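/- Simple Path Criterion (bridge outage, 'if' direction, almost surely): fix a line l = (i,j) ∈ E, a bus ĵ ∈ N, and a proportional control α. If there exists a participating bus k and a simple path in G from ĵ to k that contains line l, then the set of susceptance vectors { b ∈ (0,∞)^m : Σ_{k∈N} α_k D_{l,kĵ}(b) = 0 } has m-dimensional Lebesgue measure zero. -/

import Mathlib

open Matrix MeasureTheory

variable {n m : ℕ}

/-- Incidence matrix of an oriented network with buses `Fin (n+1)` (bus `Fin.last n` is the
reference bus) and oriented lines indexed by `Fin m` with endpoint maps `src`, `tgt`. -/
def incM (src tgt : Fin m → Fin (n+1)) : Matrix (Fin (n+1)) (Fin m) ℝ :=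
  Matrix.of fun i l => if src l = i then 1 else if tgt l = i then -1 else 0

/-- The matrix `A` built from a Laplacian `L`: its top-left `n × n` block is the inverse of the
reduced Laplacian (obtained by deleting the last row and column) and all other entries are `0`. -/
noncomputable def AmatL (L : Matrix (Fin (n+1)) (Fin (n+1)) ℝ) : Matrix (Fin (n+1)) (Fin (n+1)) ℝ :=
  Matrix.of fun i j =>
    if h : i ≠ Fin.last n ∧ j ≠ Fin.last n then
      (L.submatrix Fin.castSucc Fin.castSucc)⁻¹ (i.castPred h.1) (j.castPred h.2)
    else 0

/-- The matrix `A` of the network with susceptance vector `b`. -/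
noncomputable def Amat (src tgt : Fin m → Fin (n+1)) (b : Fin m → ℝ) : Matrix (Fin (n+1)) (Fin (n+1)) ℝ :=
  AmatL (incM src tgt * Matrix.diagonal b * (incM src tgt)ᵀ)

/-- Power transfer distribution factor `D_{l, k ĵ}`. -/
noncomputable def ptdf (src tgt : Fin m → Fin (n+1)) (b : Fin m → ℝ) (l : Fin m) (k jh : Fin (n+1)) : ℝ :=
  b l * (Amat src tgt b (src l) k + Amat src tgt b (tgt l) jh
       - Amat src tgt b (src l) jh - Amat src tgt b (tgt l) k)

/-- The underlying simple graph of the network. -/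
def netGraph (src tgt : Fin m → Fin (n+1)) : SimpleGraph (Fin (n+1)) :=
  SimpleGraph.fromRel fun a c => ∃ l, src l = a ∧ tgt l = c

/-- There is a simple path in the network from `jh` to `k` that contains line `l`. -/
def PathThrough (src tgt : Fin m → Fin (n+1)) (jh k : Fin (n+1)) (l : Fin m) : Prop :=
  ∃ w : (netGraph src tgt).Walk jh k, w.IsPath ∧ s(src l, tgt l) ∈ w.edges

/-- Lines `e₁` and `e₂` belong to the same block: they are equal or lie on a common simple cycle. -/
def sameBlock (src tgt : Fin m → Fin (n+1)) (e₁ e₂ : Fin m) : Prop :=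
  e₁ = e₂ ∨ ∃ (v : Fin (n+1)) (c : (netGraph src tgt).Walk v v),
    c.IsCycle ∧ s(src e₁, tgt e₁) ∈ c.edges ∧ s(src e₂, tgt e₂) ∈ c.edges

/-- A cut vertex: a vertex whose removal disconnects the graph. -/
def IsCutVertex {V : Type*} (G : SimpleGraph V) (v : V) : Prop :=
  ¬ (G.induce {w : V | w ≠ v}).Connected

/-- The subgraph of the network with only the lines in `S`. -/
def netGraphOn (src tgt : Fin m → Fin (n+1)) (S : Set (Fin m)) : SimpleGraph (Fin (n+1)) :=
  SimpleGraph.fromRel fun a c => ∃ l ∈ S, src l = a ∧ tgt l = c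

def maskIn (F : Finset (Fin m)) (b : Fin m → ℝ) : Fin m → ℝ := fun l => if l ∈ F then b l else 0
def maskOut (F : Finset (Fin m)) (b : Fin m → ℝ) : Fin m → ℝ := fun l => if l ∈ F then 0 else b l

/-- Column submatrix `C_F` (columns outside `F` zeroed out). -/
def CFmat (src tgt : Fin m → Fin (n+1)) (F : Finset (Fin m)) : Matrix (Fin (n+1)) (Fin m) ℝ :=
  Matrix.of fun i l => if l ∈ F then incM src tgt i l else 0

/-- Column submatrix `C_{−F}` (columns in `F` zeroed out). -/
def CmFmat (src tgt : Fin m → Fin (n+1)) (F : Finset (Fin m)) : Matrix (Fin (n+1)) (Fin m) ℝ :=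
  Matrix.of fun i l => if l ∈ F then 0 else incM src tgt i l

/-- Diagonal susceptance matrix `B_F`. -/
def BFmat (b : Fin m → ℝ) (F : Finset (Fin m)) : Matrix (Fin m) (Fin m) ℝ :=
  Matrix.diagonal (maskIn F b)

/-- Diagonal susceptance matrix `B_{−F}`. -/
def BmFmat (b : Fin m → ℝ) (F : Finset (Fin m)) : Matrix (Fin m) (Fin m) ℝ :=
  Matrix.diagonal (maskOut F b)

/-- The matrix `A_{−F}` of the post-contingency network `(N, E ∖ F)`. -/
noncomputable def AmFmat (src tgt : Fin m → Fin (n+1)) (b : Fin m → ℝ) (F : Finset (Fin m)) :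
    Matrix (Fin (n+1)) (Fin (n+1)) ℝ :=
  AmatL (CmFmat src tgt F * BmFmat b F * (CmFmat src tgt F)ᵀ)

/-- The `k`-th standard unit vector of `ℝ^{n+1}`. -/
def evec (k : Fin (n+1)) : Fin (n+1) → ℝ := Pi.single k 1

/-- Zero sets of nonzero real polynomials are Lebesgue-null. -/
theorem mvpoly_null : ∀ (m : ℕ) (P : MvPolynomial (Fin m) ℝ), P ≠ 0 →
    volume {b : Fin m → ℝ | MvPolynomial.eval b P = 0} = 0 := by
  intro m
  induction m with
  | zero =>
    intro P hP
    have : {b : Fin 0 → ℝ | MvPolynomial.eval b P = 0} = ∅ := by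
      ext b
      simp only [Set.mem_ofPred_eq, Set.mem_empty_iff_false, iff_false]
      intro h
      apply hP
      apply MvPolynomial.funext
      intro x
      rw [Subsingleton.elim x b, h, map_zero]
    rw [this, measure_empty]
  | succ m ih =>
    intro P hP
    have hmeas : ∀ (k : ℕ) (Q : MvPolynomial (Fin k) ℝ),
        MeasurableSet {b : Fin k → ℝ | MvPolynomial.eval b Q = 0} := by
      intro k Q
      exact (isClosed_eq (MvPolynomial.continuous_eval Q) continuous_const).measurableSet
    have hmp := (volume_preserving_piFinSuccAbove (fun _ : Fin (m+1) => ℝ) 0).symm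
    rw [← hmp.measure_preimage (hmeas _ P).nullMeasurableSet]
    apply Measure.measure_prod_null_of_ae_null
    · exact hmp.measurable (hmeas _ P)
    set q := MvPolynomial.finSuccEquiv ℝ m P with hq
    have hq0 : q ≠ 0 := by
      rw [hq]; simpa using hP
    have hfin : {y : ℝ | q.eval (MvPolynomial.C y) = 0}.Finite := by
      have h1 : {r | q.IsRoot r}.Finite := Polynomial.finite_setOfPred_isRoot hq0
      exact h1.preimage (MvPolynomial.C_injective (Fin m) ℝ).injOn
    have hae : ∀ᵐ y : ℝ, y ∉ {y : ℝ | q.eval (MvPolynomial.C y) = 0} :=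
      measure_eq_zero_iff_ae_notMem.mp (hfin.measure_zero _)
    filter_upwards [hae] with y hy
    have := ih _ hy
    simp only [Pi.zero_apply]
    rw [← this]
    congr 1
    ext s
    have key : MvPolynomial.eval (Fin.cons y s : Fin (m+1) → ℝ) P
        = MvPolynomial.eval s (q.eval (MvPolynomial.C y)) := by
      rw [MvPolynomial.eval_eq_eval_mv_eval', ← hq, Polynomial.eval_map, Polynomial.eval,
        Polynomial.hom_eval₂]
      simp
    simp only [Set.mem_preimage, Set.mem_ofPred_eq, ← key]
    have e : (MeasurableEquiv.piFinSuccAbove (fun _ : Fin (m+1) => ℝ) 0).symm (y, s)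
        = (Fin.cons y s : Fin (m+1) → ℝ) := by
      simp [MeasurableEquiv.piFinSuccAbove, Fin.insertNthEquiv]
    rw [e]

/-- Function formulation of connectedness of a vertex set. -/
def FConn {V : Type*} (G : SimpleGraph V) (P : Set V) : Prop :=
  ∀ f : V → ℝ, (∀ a ∈ P, ∀ b ∈ P, G.Adj a b → f a = f b) → ∀ a ∈ P, ∀ b ∈ P, f a = f b

theorem fconn_insert {V : Type*} (G : SimpleGraph V) (P : Set V) (u v : V) (hv : v ∈ P)
    (h : G.Adj u v) (hP : FConn G P) : FConn G (insert u P) := by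
  intro f hf
  have h1 : ∀ a ∈ insert u P, f a = f v := by
    rintro a (rfl | ha)
    · exact hf _ (Set.mem_insert _ _) _ (Set.mem_insert_of_mem _ hv) h
    · exact hP f (fun a ha b hb hab => hf _ (Set.mem_insert_of_mem _ ha) _
        (Set.mem_insert_of_mem _ hb) hab) _ ha _ hv
  intro a ha b hb
  rw [h1 a ha, h1 b hb]

theorem fconn_support {V : Type*} (G : SimpleGraph V) {u v : V} (w : G.Walk u v) :
    FConn G {x | x ∈ w.support} := by
  induction w with
  | nil =>
    intro f hf a ha b hb
    simp at ha hb
    rw [ha, hb]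
  | @cons u v w h p ih =>
    have := fconn_insert G _ u v (by simp) h ih
    convert this using 1
    ext x; simp

theorem path_split {V : Type*} (G : SimpleGraph V) (a c : V) {u v : V} (w : G.Walk u v)
    (hw : w.IsPath) (he : s(a, c) ∈ w.edges) :
    ∃ (P Q : Set V) (x y : V), s(x, y) = s(a, c) ∧ u ∈ P ∧ x ∈ P ∧ y ∈ Q ∧ v ∈ Q ∧
      FConn G P ∧ FConn G Q ∧ (∀ t ∈ P, t ∉ Q) ∧ (∀ t ∈ P, t ∈ w.support) ∧
      (∀ t ∈ Q, t ∈ w.support) := by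
  induction w with
  | nil => simp at he
  | @cons u t v h p ih =>
    rw [SimpleGraph.Walk.cons_isPath_iff] at hw
    by_cases h1 : s(a, c) = s(u, t)
    · refine ⟨{u}, {x | x ∈ p.support}, u, t, h1.symm, rfl, rfl, by simp, by simp, ?_,
        fconn_support G p, ?_, ?_, ?_⟩
      · rintro f - a rfl b rfl; rfl
      · rintro t rfl; exact hw.2
      · rintro t rfl; simp
      · intro t ht; simp only [Set.mem_ofPred_eq] at ht; simp [ht]
    · have he' : s(a, c) ∈ p.edges := by
        rw [SimpleGraph.Walk.edges_cons, List.mem_cons] at he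
        exact he.resolve_left h1
      obtain ⟨P, Q, x, y, hxy, hu, hx, hy, hv, hP, hQ, hd, hPs, hQs⟩ := ih hw.1 he'
      refine ⟨insert u P, Q, x, y, hxy, Set.mem_insert _ _, Set.mem_insert_of_mem _ hx, hy, hv,
        fconn_insert G P u t hu h hP, hQ, ?_, ?_, ?_⟩
      · rintro s (rfl | hs)
        · intro hq; exact hw.2 (hQs _ hq)
        · exact hd s hs
      · rintro s (rfl | hs)
        · simp
        · simp [hPs s hs]
      · intro s hs; simp [hQs s hs]

/-- A connected bipartition separated by the edge. -/
theorem exists_cut {V : Type*} (G : SimpleGraph V) (hG : G.Connected) (a c : V) {u v : V}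
    (w : G.Walk u v) (hw : w.IsPath) (he : s(a, c) ∈ w.edges) :
    ∃ S : Set V, u ∉ S ∧ v ∈ S ∧ (a ∈ S ↔ c ∉ S) ∧
      ∀ f : V → ℝ, f a = f c → (∀ p q, G.Adj p q → (p ∈ S ↔ q ∈ S) → f p = f q) →
        ∀ p q, f p = f q := by
  classical
  obtain ⟨P, Q, x, y, hxy, hu, hx, hy, hv, hP, hQ, hd, -, -⟩ := path_split G a c w hw he
  set R : V → V → Prop := fun p q => G.Adj p q ∧ q ∉ P with hR
  set S : Set V := {z | Relation.ReflTransGen R y z} with hS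
  have hyP : y ∉ P := fun h => hd y h hy
  have hSP : ∀ z ∈ S, z ∉ P := by
    intro z hz
    rcases Relation.ReflTransGen.cases_tail hz with h | ⟨t, -, h⟩
    · rw [h]; exact hyP
    · exact h.2
  have hstep : ∀ p q, p ∈ S → G.Adj p q → q ∉ P → q ∈ S := fun p q hp h hq =>
    Relation.ReflTransGen.tail hp ⟨h, hq⟩
  have hyS : y ∈ S := Relation.ReflTransGen.refl
  have hQS : ∀ z ∈ Q, z ∈ S := by
    intro z hz
    have := hQ (fun t => if t ∈ S then 1 else 0) (by
      intro p hp q hq hpq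
      have : p ∈ S ↔ q ∈ S := ⟨fun h => hstep _ _ h hpq (fun h' => hd _ h' hq),
        fun h => hstep _ _ h hpq.symm (fun h' => hd _ h' hp)⟩
      simp only [this]) z hz y hy
    by_contra hcon
    simp [hcon, hyS] at this
  have hxS : x ∉ S := fun h => hSP _ h hx
  refine ⟨S, fun h => hSP _ h hu, hQS _ hv, ?_, ?_⟩
  · rcases Sym2.eq_iff.mp hxy with ⟨rfl, rfl⟩ | ⟨rfl, rfl⟩ <;> simp [hxS, hyS]
  · intro f hac hf
    have hxyf : f x = f y := by
      rcases Sym2.eq_iff.mp hxy with ⟨rfl, rfl⟩ | ⟨rfl, rfl⟩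
      · exact hac
      · exact hac.symm
    have h1 : ∀ z ∈ S, f z = f x := by
      intro z hz
      rw [hxyf]
      induction hz with
      | refl => rfl
      | @tail p q hp hpq ih =>
        have hp' : p ∈ S := hp
        rw [← ih, hf p q hpq.1 ⟨fun _ => hstep _ _ hp' hpq.1 hpq.2, fun _ => hp'⟩]
    have hPx : ∀ z ∈ P, f z = f x := fun z hz => hP f (fun p hp q hq hpq =>
      hf p q hpq ⟨fun h => absurd hp (hSP _ h), fun h => absurd hq (hSP _ h)⟩) z hz x hx
    have h2 : ∀ p q : V, ∀ w : G.Walk p q, q = x → p ∉ S → f p = f x := by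
      intro p q w
      induction w with
      | nil => rintro rfl _; rfl
      | @cons p t q h w' ih =>
        intro hq hp
        by_cases hpP : p ∈ P
        · exact hPx p hpP
        · have ht : t ∉ S := fun ht => hp (hstep _ _ ht h.symm hpP)
          rw [← ih hq ht]
          exact hf p t h (by simp [hp, ht])
    have h3 : ∀ p, f p = f x := by
      intro p
      by_cases hp : p ∈ S
      · exact h1 p hp
      · obtain ⟨w⟩ := hG.preconnected p x
        exact h2 p x w rfl hp
    intro p q
    rw [h3 p, h3 q]

theorem vecMul_incM {n m : ℕ} (src tgt : Fin m → Fin (n+1)) (hsl : ∀ l, src l ≠ tgt l)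
    (z : Fin (n+1) → ℝ) (e : Fin m) : (z ᵥ* incM src tgt) e = z (src e) - z (tgt e) := by
  have : ∀ i, z i * incM src tgt i e
      = (if src e = i then z i else 0) - (if tgt e = i then z i else 0) := by
    intro i
    have := hsl e
    simp only [incM, Matrix.of_apply]
    split_ifs with h1 h2 <;> simp
    exact absurd (h1.trans h2.symm) this
  simp [Matrix.vecMul, dotProduct, this, Finset.sum_sub_distrib]

theorem lap_form {n m : ℕ} (src tgt : Fin m → Fin (n+1)) (hsl : ∀ l, src l ≠ tgt l)
    (b : Fin m → ℝ) (z x : Fin (n+1) → ℝ) :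
    z ⬝ᵥ ((incM src tgt * Matrix.diagonal b * (incM src tgt)ᵀ) *ᵥ x)
      = ∑ e, b e * (z (src e) - z (tgt e)) * (x (src e) - x (tgt e)) := by
  rw [← Matrix.mulVec_mulVec, ← Matrix.mulVec_mulVec, Matrix.dotProduct_mulVec,
    Matrix.mulVec_transpose, dotProduct]
  refine Finset.sum_congr rfl fun e _ => ?_
  rw [Matrix.mulVec_diagonal, vecMul_incM _ _ hsl, vecMul_incM _ _ hsl]
  ring

theorem reduced_form {n : ℕ} (L : Matrix (Fin (n+1)) (Fin (n+1)) ℝ) (z x : Fin (n+1) → ℝ)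
    (hz : z (Fin.last n) = 0) (hx : x (Fin.last n) = 0) :
    z ⬝ᵥ (L *ᵥ x) = (fun i : Fin n => z i.castSucc) ⬝ᵥ
      ((L.submatrix Fin.castSucc Fin.castSucc) *ᵥ fun i : Fin n => x i.castSucc) := by
  simp [dotProduct, Matrix.mulVec, Fin.sum_univ_castSucc, hz, hx]

/-- Extension by zero. -/
def extM {R : Type*} [Zero R] {n : ℕ} (K : Matrix (Fin n) (Fin n) R) (i j : Fin (n+1)) : R :=
  if h : i ≠ Fin.last n ∧ j ≠ Fin.last n then K (i.castPred h.1) (j.castPred h.2) else 0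

theorem sum_ptdf {n m : ℕ} (src tgt : Fin m → Fin (n+1))
    (α : Fin (n+1) → ℝ) (hα1 : ∑ k, α k = 1) (b : Fin m → ℝ)
    (l : Fin m) (jhat : Fin (n+1)) :
    ∑ k, α k * ptdf src tgt b l k jhat =
      b l * ((Amat src tgt b *ᵥ (α - Pi.single jhat 1)) (src l)
        - (Amat src tgt b *ᵥ (α - Pi.single jhat 1)) (tgt l)) := by
  have h : ∀ v, (Amat src tgt b *ᵥ (α - Pi.single jhat 1)) v
      = ∑ k, α k * (Amat src tgt b v k - Amat src tgt b v jhat) := by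
    intro v
    rw [Matrix.mulVec_sub]
    simp only [Pi.sub_apply, mul_sub, Finset.sum_sub_distrib, ← Finset.sum_mul, hα1, one_mul]
    rw [Matrix.mulVec_single_one]
    simp [Matrix.mulVec, dotProduct, mul_comm]
  rw [h, h, ← Finset.sum_sub_distrib, Finset.mul_sum]
  refine Finset.sum_congr rfl fun k _ => ?_
  rw [ptdf]; ring

/-- The reduced Laplacian. -/
noncomputable def redL {n m : ℕ} (src tgt : Fin m → Fin (n+1)) (b : Fin m → ℝ) :
    Matrix (Fin n) (Fin n) ℝ :=
  (incM src tgt * Matrix.diagonal b * (incM src tgt)ᵀ).submatrix Fin.castSucc Fin.castSucc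

theorem exists_good {n m : ℕ} (src tgt : Fin m → Fin (n+1)) (hsl : ∀ l, src l ≠ tgt l)
    (hconn : (netGraph src tgt).Connected)
    (α : Fin (n+1) → ℝ) (hα0 : ∀ k, 0 ≤ α k) (hα1 : ∑ k, α k = 1)
    (l : Fin m) (jhat : Fin (n+1))
    (hpath : ∃ k, 0 < α k ∧ PathThrough src tgt jhat k l) :
    ∃ b : Fin m → ℝ, (redL src tgt b).det ≠ 0 ∧ ∑ k, α k * ptdf src tgt b l k jhat ≠ 0 := by
  classical
  obtain ⟨k, hk, w, hw, he⟩ := hpath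
  obtain ⟨S, hjS, hkS, hlS, hS⟩ := exists_cut _ hconn _ _ w hw he
  set b : Fin m → ℝ := fun e => if e = l ∨ (src e ∈ S ↔ tgt e ∈ S) then 1 else 0 with hb
  have hbl : b l = 1 := by simp [hb]
  have hb0 : ∀ e, 0 ≤ b e := by intro e; simp only [hb]; split_ifs <;> norm_num
  have hdet : (redL src tgt b).det ≠ 0 := by
    intro h0
    obtain ⟨y, hy0, hy⟩ := Matrix.exists_mulVec_eq_zero_iff.mpr h0
    set x : Fin (n+1) → ℝ := Fin.snoc (α := fun _ => ℝ) y 0 with hx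
    have hxl : x (Fin.last n) = 0 := by simp [hx]
    have hxc : ∀ i : Fin n, x i.castSucc = y i := by intro i; simp [hx]
    have h1 := lap_form src tgt hsl b x x
    rw [reduced_form _ _ _ hxl hxl] at h1
    simp only [hxc] at h1
    change y ⬝ᵥ (redL src tgt b *ᵥ y) = _ at h1
    rw [hy, dotProduct_zero] at h1
    have hnn : ∀ e ∈ Finset.univ, 0 ≤ b e * (x (src e) - x (tgt e)) * (x (src e) - x (tgt e)) := by
      intro e _
      rw [mul_assoc]
      exact mul_nonneg (hb0 e) (mul_self_nonneg _)
    have h2 := (Finset.sum_eq_zero_iff_of_nonneg hnn).mp h1.symm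
    have h3 : ∀ e, b e = 1 → x (src e) = x (tgt e) := by
      intro e he
      have := h2 e (Finset.mem_univ _)
      rw [he, one_mul] at this
      exact sub_eq_zero.mp (mul_self_eq_zero.mp this)
    have h4 := hS x (h3 l hbl) (by
      intro p q hpq hpqS
      rw [netGraph, SimpleGraph.fromRel_adj] at hpq
      rcases hpq with ⟨-, ⟨e, rfl, rfl⟩ | ⟨e, rfl, rfl⟩⟩
      · exact h3 e (by simp [hb, hpqS])
      · exact (h3 e (by simp [hb, hpqS])).symm)
    apply hy0
    ext i
    rw [← hxc, h4 _ (Fin.last n), hxl]; rfl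
  refine ⟨b, hdet, ?_⟩
  rw [sum_ptdf _ _ _ hα1, hbl, one_mul]
  set r : Fin (n+1) → ℝ := α - Pi.single jhat 1 with hr
  set x : Fin (n+1) → ℝ := Amat src tgt b *ᵥ r with hx
  have hxl : x (Fin.last n) = 0 := by
    simp [hx, Matrix.mulVec, dotProduct, Amat, AmatL]
  have hxc : (fun i : Fin n => x i.castSucc)
      = (redL src tgt b)⁻¹ *ᵥ fun i : Fin n => r i.castSucc := by
    ext i
    simp [hx, Matrix.mulVec, dotProduct, Amat, AmatL, redL, Fin.sum_univ_castSucc,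
      Fin.castSucc_ne_last]
  set c : ℝ := if Fin.last n ∈ S then 1 else 0 with hc
  set z : Fin (n+1) → ℝ := fun v => (if v ∈ S then 1 else 0) - c with hz
  have hzl : z (Fin.last n) = 0 := by simp [hz, hc]
  have h1 := lap_form src tgt hsl b z x
  rw [reduced_form _ _ _ hzl hxl, hxc] at h1
  change _ ⬝ᵥ (redL src tgt b *ᵥ _) = _ at h1
  rw [Matrix.mulVec_mulVec, Matrix.mul_nonsing_inv _ (isUnit_iff_ne_zero.mpr hdet),
    Matrix.one_mulVec] at h1
  have h2 : (fun i : Fin n => z i.castSucc) ⬝ᵥ (fun i : Fin n => r i.castSucc) = ∑ v, z v * r v := by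
    simp [dotProduct, Fin.sum_univ_castSucc, hzl]
  have hrsum : ∑ v, r v = 0 := by simp [hr, hα1]
  have h3 : ∑ v, z v * r v = ∑ v, if v ∈ S then α v else 0 := by
    simp only [hz, sub_mul, Finset.sum_sub_distrib, ← Finset.mul_sum, hrsum, mul_zero, sub_zero]
    refine Finset.sum_congr rfl fun v _ => ?_
    by_cases hv : v ∈ S
    · have : v ≠ jhat := fun h => hjS (h ▸ hv)
      simp [hv, hr, this]
    · simp [hv]
  have h4 : 0 < ∑ v, if v ∈ S then α v else 0 := by
    apply Finset.sum_pos'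
    · intro v _; split_ifs; exacts [hα0 v, le_rfl]
    · exact ⟨k, Finset.mem_univ _, by simpa [hkS] using hk⟩
  have h5 : ∑ e, b e * (z (src e) - z (tgt e)) * (x (src e) - x (tgt e))
      = (z (src l) - z (tgt l)) * (x (src l) - x (tgt l)) := by
    rw [Finset.sum_eq_single l]
    · rw [hbl, one_mul]
    · intro e _ hel
      by_cases hes : src e ∈ S ↔ tgt e ∈ S
      · simp [hz, hes]
      · simp [hb, hel, hes]
    · simp
  intro h0
  rw [h5, h0, mul_zero, h2, h3] at h1
  exact h4.ne' h1

/-- Reduced Laplacian over polynomials. -/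
noncomputable def redP {n m : ℕ} (src tgt : Fin m → Fin (n+1)) :
    Matrix (Fin n) (Fin n) (MvPolynomial (Fin m) ℝ) :=
  Matrix.of fun i j => ∑ e, MvPolynomial.C (incM src tgt i.castSucc e) * MvPolynomial.X e *
    MvPolynomial.C (incM src tgt j.castSucc e)

theorem redP_map {n m : ℕ} (src tgt : Fin m → Fin (n+1)) (b : Fin m → ℝ) :
    (MvPolynomial.eval b).mapMatrix (redP src tgt) = redL src tgt b := by
  ext i j
  rw [redL, Matrix.submatrix_apply, Matrix.mul_apply]
  simp only [Matrix.mul_diagonal]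
  simp [redP]

theorem extM_map {n m : ℕ} (src tgt : Fin m → Fin (n+1)) (b : Fin m → ℝ) (i j : Fin (n+1)) :
    MvPolynomial.eval b (extM (redP src tgt).adjugate i j) = extM (redL src tgt b).adjugate i j := by
  rw [← redP_map, ← RingHom.map_adjugate]
  simp only [extM]
  split_ifs <;> simp

theorem Amat_eq {n m : ℕ} (src tgt : Fin m → Fin (n+1)) (b : Fin m → ℝ) (i j : Fin (n+1)) :
    Amat src tgt b i j = Ring.inverse (redL src tgt b).det * extM (redL src tgt b).adjugate i j := by
  simp only [Amat, AmatL, extM, Matrix.of_apply]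
  split_ifs
  · rw [Matrix.inv_def]; rfl
  · simp

/-- The numerator polynomial. -/
noncomputable def numP {n m : ℕ} (src tgt : Fin m → Fin (n+1)) (α : Fin (n+1) → ℝ)
    (l : Fin m) (jh : Fin (n+1)) : MvPolynomial (Fin m) ℝ :=
  ∑ k, MvPolynomial.C (α k) * (MvPolynomial.X l *
    (extM (redP src tgt).adjugate (src l) k + extM (redP src tgt).adjugate (tgt l) jh
      - extM (redP src tgt).adjugate (src l) jh - extM (redP src tgt).adjugate (tgt l) k))

theorem sum_eq_numP {n m : ℕ} (src tgt : Fin m → Fin (n+1)) (α : Fin (n+1) → ℝ)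
    (l : Fin m) (jh : Fin (n+1)) (b : Fin m → ℝ) :
    ∑ k, α k * ptdf src tgt b l k jh =
      Ring.inverse (redL src tgt b).det * MvPolynomial.eval b (numP src tgt α l jh) := by
  simp only [numP, map_sum, map_mul, map_sub, map_add, extM_map, MvPolynomial.eval_C,
    MvPolynomial.eval_X, Finset.mul_sum, ptdf, Amat_eq]
  refine Finset.sum_congr rfl fun k _ => ?_
  ring

/-- Simple Path Criterion, bridge outage, 'if' direction, almost surely.
If there is a participating bus `k` and a simple path in the network from `jhat` to `k`
containing line `l`, then the set of positive susceptance vectors for which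
`∑_k α_k D_{l,kĵ}(b) = 0` has `m`-dimensional Lebesgue measure zero. -/
theorem simple_path_criterion_if_ae
    {n m : ℕ} (src tgt : Fin m → Fin (n+1)) (hsl : ∀ l, src l ≠ tgt l)
    (hconn : (netGraph src tgt).Connected)
    (α : Fin (n+1) → ℝ) (hα0 : ∀ k, 0 ≤ α k) (hα1 : ∑ k, α k = 1)
    (l : Fin m) (jhat : Fin (n+1))
    (hpath : ∃ k, 0 < α k ∧ PathThrough src tgt jhat k l) :
    volume {b : Fin m → ℝ | (∀ e, 0 < b e) ∧ ∑ k, α k * ptdf src tgt b l k jhat = 0} = 0 := by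
  obtain ⟨b₀, hd, hs⟩ := exists_good src tgt hsl hconn α hα0 hα1 l jhat hpath
  have hdet : ∀ b, MvPolynomial.eval b (redP src tgt).det = (redL src tgt b).det := by
    intro b
    rw [← redP_map, RingHom.map_det]
  have hP : (redP src tgt).det * numP src tgt α l jhat ≠ 0 := by
    intro h
    have h' := congrArg (MvPolynomial.eval b₀) h
    rw [map_mul, map_zero, hdet] at h'
    rcases mul_eq_zero.mp h' with h1 | h1
    · exact hd h1
    · exact hs (by rw [sum_eq_numP, h1, mul_zero])
  refine measure_mono_null ?_ (mvpoly_null m _ hP)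
  rintro b ⟨-, hb⟩
  rw [sum_eq_numP] at hb
  simp only [Set.mem_ofPred_eq, map_mul, hdet]
  rcases mul_eq_zero.mp hb with h1 | h1
  · rw [Ring.inverse_eq_inv', inv_eq_zero] at h1
    rw [h1, zero_mul]
  · rw [h1, mul_zero]
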